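/- Suppose A is generated by two axes a and b of Jordan type (λ,δ) and (λ',δ') respectively, with λ ≠ δ, λ' ≠ δ', and dim_F A = 3. Then λ + δ = 1, λ' = δ, δ' = λ, and setting x := b_{λ,δ} (the component of b in A_{λ,δ}(a)), one has A = F·a ⊕ F·b ⊕ F·x with x² = 0, a·b = a·x = x·b = λ·x, and b·a = x·a = b·x = δ·x. -/

import Mathlib

/-! Common definitions: eigenspaces of left/right multiplication, axes, Jordan axes,
in a not-necessarily-associative, not-necessarily-commutative, not-necessarily-unital
algebra `A` over a field `F`. -/

variable (F : Type*) [Field F]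
variable (A : Type*) [NonUnitalNonAssocRing A] [Module F A]
  [SMulCommClass F A A] [IsScalarTower F A A]

/-- `leftEig F A a l = A_l(L_a) = {v : A | a * v = l • v}`, as a submodule of `A`. -/
def leftEig (a : A) (l : F) : Submodule F A where
  carrier := {v | a * v = l • v}
  add_mem' := by
    intro x y hx hy
    simp only [Set.mem_setOf_eq] at *
    rw [mul_add, hx, hy, smul_add]
  zero_mem' := by simp
  smul_mem' := by
    intro c x hx
    simp only [Set.mem_setOf_eq] at *
    rw [mul_smul_comm, hx, smul_comm]

/-- `rightEig F A a l = A_l(R_a) = {v : A | v * a = l • v}`, as a submodule of `A`. -/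
def rightEig (a : A) (l : F) : Submodule F A where
  carrier := {v | v * a = l • v}
  add_mem' := by
    intro x y hx hy
    simp only [Set.mem_setOf_eq] at *
    rw [add_mul, hx, hy, smul_add]
  zero_mem' := by simp
  smul_mem' := by
    intro c x hx
    simp only [Set.mem_setOf_eq] at *
    rw [smul_mul_assoc, hx, smul_comm]

/-- `eig2 F A a l d = A_{l,d}(a) = A_l(L_a) ⊓ A_d(R_a)`. -/
def eig2 (a : A) (l d : F) : Submodule F A :=
  leftEig F A a l ⊓ rightEig F A a d

/-- `a` is a left axis of type `l` (with `l ∉ {0,1}`):  an absolutely primitive idempotent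
whose left multiplication operator satisfies `(L_a - l)(L_a - 1)L_a = 0`, such that the
eigenspace decomposition `A = A_0(L_a) ⊕ A_1(L_a) ⊕ A_l(L_a)` is a ℤ/2-grading with
plus part `A_0(L_a) ⊕ A_1(L_a)` and minus part `A_l(L_a)`. -/
structure IsLeftAxis (l : F) (a : A) : Prop where
  l_ne_zero : l ≠ 0
  l_ne_one : l ≠ 1
  idem : a * a = a
  prim : leftEig F A a 1 = Submodule.span F {a}
  cube : ∀ v : A, a * (a * (a * v)) - a * (a * v) - l • (a * (a * v)) + l • (a * v) = 0
  decomp : leftEig F A a 0 ⊔ leftEig F A a 1 ⊔ leftEig F A a l = ⊤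
  fusePP : ∀ x ∈ leftEig F A a 0 ⊔ leftEig F A a 1, ∀ y ∈ leftEig F A a 0 ⊔ leftEig F A a 1,
      x * y ∈ leftEig F A a 0 ⊔ leftEig F A a 1
  fusePM : ∀ x ∈ leftEig F A a 0 ⊔ leftEig F A a 1, ∀ y ∈ leftEig F A a l,
      x * y ∈ leftEig F A a l
  fuseMP : ∀ x ∈ leftEig F A a l, ∀ y ∈ leftEig F A a 0 ⊔ leftEig F A a 1,
      x * y ∈ leftEig F A a l
  fuseMM : ∀ x ∈ leftEig F A a l, ∀ y ∈ leftEig F A a l,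
      x * y ∈ leftEig F A a 0 ⊔ leftEig F A a 1

/-- `a` is a right axis of type `d`: the symmetric notion with `R_a` in place of `L_a`. -/
structure IsRightAxis (d : F) (a : A) : Prop where
  d_ne_zero : d ≠ 0
  d_ne_one : d ≠ 1
  idem : a * a = a
  prim : rightEig F A a 1 = Submodule.span F {a}
  cube : ∀ v : A, v * a * a * a - v * a * a - d • (v * a * a) + d • (v * a) = 0
  decomp : rightEig F A a 0 ⊔ rightEig F A a 1 ⊔ rightEig F A a d = ⊤
  fusePP : ∀ x ∈ rightEig F A a 0 ⊔ rightEig F A a 1, ∀ y ∈ rightEig F A a 0 ⊔ rightEig F A a 1,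
      x * y ∈ rightEig F A a 0 ⊔ rightEig F A a 1
  fusePM : ∀ x ∈ rightEig F A a 0 ⊔ rightEig F A a 1, ∀ y ∈ rightEig F A a d,
      x * y ∈ rightEig F A a d
  fuseMP : ∀ x ∈ rightEig F A a d, ∀ y ∈ rightEig F A a 0 ⊔ rightEig F A a 1,
      x * y ∈ rightEig F A a d
  fuseMM : ∀ x ∈ rightEig F A a d, ∀ y ∈ rightEig F A a d,
      x * y ∈ rightEig F A a 0 ⊔ rightEig F A a 1

/-- `a` is a (two-sided) axis of type `(l, d)`. -/
structure IsAxis (l d : F) (a : A) : Prop where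
  toLeft : IsLeftAxis F A l a
  toRight : IsRightAxis F A d a
  comm : ∀ v : A, a * (v * a) = (a * v) * a

/-- `a` is an axis of Jordan type `(l, d)`: an axis of type `(l, d)` with
`A_{l,0}(a) = A_{0,d}(a) = 0`, so that `A = F·a ⊕ A_{0,0}(a) ⊕ A_{l,d}(a)`. -/
structure IsJordanAxis (l d : F) (a : A) extends IsAxis F A l d a : Prop where
  j_left : eig2 F A a l 0 = ⊥
  j_right : eig2 F A a 0 d = ⊥

section

variable {F A}

lemma mem_leftEig {a v : A} {l : F} : v ∈ leftEig F A a l ↔ a * v = l • v := Iff.rfl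

lemma mem_rightEig {a v : A} {l : F} : v ∈ rightEig F A a l ↔ v * a = l • v := Iff.rfl

lemma mem_eig2 {a v : A} {l d : F} : v ∈ eig2 F A a l d ↔ a * v = l • v ∧ v * a = d • v := Iff.rfl

lemma mul_mem_leftEig_of_commute {a v : A} {l : F} (hc : ∀ v : A, a * (v * a) = (a * v) * a)
    (hv : v ∈ leftEig F A a l) : v * a ∈ leftEig F A a l := by
  rw [mem_leftEig] at *
  rw [hc, hv, smul_mul_assoc]

namespace IsLeftAxis

variable {l : F} {a : A}

lemma mul_mul_of_mem_plus {v : A} (h : IsLeftAxis F A l a)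
    (hv : v ∈ leftEig F A a 0 ⊔ leftEig F A a 1) : a * (a * v) = a * v := by
  obtain ⟨u, hu, w, hw, rfl⟩ := Submodule.mem_sup.1 hv
  rw [h.prim, Submodule.mem_span_singleton] at hw
  obtain ⟨k, rfl⟩ := hw
  rw [mem_leftEig, zero_smul] at hu
  simp [mul_add, hu, mul_smul_comm, h.idem]

lemma eq_zero_of_mem_plus_of_mem_minus {v : A} (h : IsLeftAxis F A l a)
    (hp : v ∈ leftEig F A a 0 ⊔ leftEig F A a 1) (hm : v ∈ leftEig F A a l) : v = 0 := by
  have h1 := h.mul_mul_of_mem_plus hp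
  rw [mem_leftEig] at hm
  rw [hm, mul_smul_comm, hm, smul_right_inj h.l_ne_zero] at h1
  have h2 : (l - 1) • v = 0 := by rw [sub_smul, one_smul, h1, sub_self]
  exact (smul_eq_zero.1 h2).resolve_left (sub_ne_zero.2 h.l_ne_one)

end IsLeftAxis

lemma IsRightAxis.exists_decomposition {d : F} {a : A} (h : IsRightAxis F A d a) (v : A) :
    ∃ (k : F) (u w : A), u * a = 0 ∧ w * a = d • w ∧ v = k • a + u + w := by
  have hv : v ∈ rightEig F A a 0 ⊔ rightEig F A a 1 ⊔ rightEig F A a d := by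
    rw [h.decomp]; trivial
  obtain ⟨s, hs, w, hw, rfl⟩ := Submodule.mem_sup.1 hv
  obtain ⟨u, hu, t, ht, rfl⟩ := Submodule.mem_sup.1 hs
  rw [h.prim, Submodule.mem_span_singleton] at ht
  obtain ⟨k, rfl⟩ := ht
  rw [mem_rightEig, zero_smul] at hu
  exact ⟨k, u, w, hu, hw, by abel⟩

lemma IsLeftAxis.exists_decomposition {l : F} {a : A} (h : IsLeftAxis F A l a) (v : A) :
    ∃ (k : F) (u w : A), a * u = 0 ∧ a * w = l • w ∧ v = k • a + u + w := by
  have hv : v ∈ leftEig F A a 0 ⊔ leftEig F A a 1 ⊔ leftEig F A a l := by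
    rw [h.decomp]; trivial
  obtain ⟨s, hs, w, hw, rfl⟩ := Submodule.mem_sup.1 hv
  obtain ⟨u, hu, t, ht, rfl⟩ := Submodule.mem_sup.1 hs
  rw [h.prim, Submodule.mem_span_singleton] at ht
  obtain ⟨k, rfl⟩ := ht
  rw [mem_leftEig, zero_smul] at hu
  exact ⟨k, u, w, hu, hw, by abel⟩

namespace IsJordanAxis

variable {l d : F} {a : A}

lemma mul_eq_zero_of_mul_eq_zero (h : IsJordanAxis F A l d a) {v : A} (hv : a * v = 0) :
    v * a = 0 := by
  obtain ⟨k, u, w, hu, hw, e⟩ := h.toRight.exists_decomposition v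
  have hv' : v ∈ leftEig F A a 0 := by rw [mem_leftEig, hv, zero_smul]
  have h1 := mul_mem_leftEig_of_commute h.comm hv'
  have h2 := mul_mem_leftEig_of_commute h.comm h1
  have e1 : v * a = k • a + d • w := by
    simp [e, add_mul, smul_mul_assoc, h.toLeft.idem, hu, hw]
  have e2 : v * a * a = k • a + (d * d) • w := by
    simp [e1, add_mul, smul_mul_assoc, h.toLeft.idem, hw, smul_smul]
  have e3 : v * a * a - v * a = (d * (d - 1)) • w := by rw [e2, e1]; module
  have hd : d * (d - 1) ≠ 0 := mul_ne_zero h.toRight.d_ne_zero (sub_ne_zero.2 h.toRight.d_ne_one)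
  have hw0 : w ∈ leftEig F A a 0 := by
    rw [← Submodule.smul_mem_iff _ hd, ← e3]
    exact sub_mem h2 h1
  have hwz : w = 0 := by
    have : w ∈ eig2 F A a 0 d := ⟨hw0, hw⟩
    rwa [h.j_right, Submodule.mem_bot] at this
  rw [hwz, smul_zero, add_zero] at e1
  rw [e1, mem_leftEig, mul_smul_comm, h.toLeft.idem, zero_smul] at h1
  rw [e1, h1]

lemma mul_eq_smul_of_mul_eq_smul (h : IsJordanAxis F A l d a) {v : A} (hv : a * v = l • v) :
    v * a = d • v := by
  obtain ⟨k, u, w, hu, hw, e⟩ := h.toRight.exists_decomposition v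
  have hv' : v ∈ leftEig F A a l := hv
  have h1 := mul_mem_leftEig_of_commute h.comm hv'
  have h2 := mul_mem_leftEig_of_commute h.comm h1
  have e1 : v * a = k • a + d • w := by
    simp [e, add_mul, smul_mul_assoc, h.toLeft.idem, hu, hw]
  have e2 : v * a * a = k • a + (d * d) • w := by
    simp [e1, add_mul, smul_mul_assoc, h.toLeft.idem, hw, smul_smul]
  have e3 : v * a * a - d • (v * a) = (1 - d) • (k • a) := by rw [e2, e1]; module
  have hd : 1 - d ≠ 0 := sub_ne_zero.2 h.toRight.d_ne_one.symm
  have hk : k • a ∈ leftEig F A a l := by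
    rw [← Submodule.smul_mem_iff _ hd, ← e3]
    exact sub_mem h2 (Submodule.smul_mem _ _ h1)
  have hkz : k • a = 0 := by
    refine h.toLeft.eq_zero_of_mem_plus_of_mem_minus (Submodule.mem_sup_right ?_) hk
    rw [h.toLeft.prim]
    exact Submodule.smul_mem _ _ (Submodule.mem_span_singleton_self a)
  rw [hkz, zero_add] at e e1
  have e4 : d • v - v * a = d • u := by rw [e1, e]; module
  have hul : u ∈ leftEig F A a l := by
    rw [← Submodule.smul_mem_iff _ h.toRight.d_ne_zero, ← e4]
    exact sub_mem (Submodule.smul_mem _ _ hv') h1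
  have huz : u = 0 := by
    have : u ∈ eig2 F A a l 0 := ⟨hul, hu.trans (zero_smul F u).symm⟩
    rwa [h.j_left, Submodule.mem_bot] at this
  rw [e1, e, huz, zero_add]

lemma exists_decomposition (h : IsJordanAxis F A l d a) (v : A) :
    ∃ (k : F) (u w : A), u ∈ eig2 F A a 0 0 ∧ w ∈ eig2 F A a l d ∧ v = k • a + u + w := by
  obtain ⟨k, u, w, hu, hw, e⟩ := h.toLeft.exists_decomposition v
  refine ⟨k, u, w, mem_eig2.2 ⟨?_, ?_⟩, mem_eig2.2 ⟨hw, h.mul_eq_smul_of_mul_eq_smul hw⟩, e⟩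
  · rw [hu, zero_smul]
  · rw [h.mul_eq_zero_of_mul_eq_zero hu, zero_smul]

/-- If `v = u + w` is idempotent with `u` in the zero part and `w ≠ 0` an eigenvector of `v`,
then the eigenvalues of `w` with respect to `v` sum to one. -/
lemma add_eq_one_of_idempotent (h : IsJordanAxis F A l d a) {v u w : A} {p q : F}
    (hu : u ∈ eig2 F A a 0 0) (hw : w ∈ eig2 F A a l d) (hv : v = u + w) (hidem : v * v = v)
    (hvw : v * w = p • w) (hwv : w * v = q • w) (hw0 : w ≠ 0) : p + q = 1 := by
  have hup : u ∈ leftEig F A a 0 ⊔ leftEig F A a 1 := Submodule.mem_sup_left hu.1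
  have huu := h.toLeft.fusePP u hup u hup
  have hww := h.toLeft.fuseMM w hw.1 w hw.1
  have e : u * u - w * w - u = (1 - p - q) • w := by
    have : u = v - w := by rw [hv]; abel
    rw [this, mul_sub, sub_mul, sub_mul, hidem, hvw, hwv]
    module
  have hz := h.toLeft.eq_zero_of_mem_plus_of_mem_minus
    (e ▸ sub_mem (sub_mem huu hww) hup) (Submodule.smul_mem _ _ hw.1)
  linear_combination -(smul_eq_zero.1 hz).resolve_right hw0

/-- If `v = u + w` with `u` in the zero part and `w` an eigenvector of `v`, then `w` squares to
zero. -/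
lemma mul_self_eq_zero_of_mul_eq_smul (h : IsJordanAxis F A l d a) {v u w : A} {p : F}
    (hu : u ∈ eig2 F A a 0 0) (hw : w ∈ eig2 F A a l d) (hv : v = u + w)
    (hvw : v * w = p • w) : w * w = 0 := by
  have huw := h.toLeft.fusePM u (Submodule.mem_sup_left hu.1) w hw.1
  refine h.toLeft.eq_zero_of_mem_plus_of_mem_minus (h.toLeft.fuseMM w hw.1 w hw.1) ?_
  have e : w * w = p • w - u * w := by rw [← hvw, hv]; noncomm_ring
  rw [e]
  exact sub_mem (Submodule.smul_mem _ _ hw.1) huw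

/-- Components with respect to a Jordan axis are unique. -/
lemma components_eq_zero (h : IsJordanAxis F A l d a) {k : F} {u w : A}
    (hu : u ∈ eig2 F A a 0 0) (hw : w ∈ eig2 F A a l d) (e : k • a + u + w = 0) :
    k • a = 0 ∧ u = 0 ∧ w = 0 := by
  have ha : k • a ∈ leftEig F A a 1 := by
    rw [h.toLeft.prim]
    exact Submodule.smul_mem _ _ (Submodule.mem_span_singleton_self a)
  have hwz : w = 0 := by
    refine h.toLeft.eq_zero_of_mem_plus_of_mem_minus ?_ hw.1
    rw [eq_neg_of_add_eq_zero_right e]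
    exact neg_mem (add_mem (Submodule.mem_sup_right ha) (Submodule.mem_sup_left hu.1))
  rw [hwz, add_zero] at e
  have hk : k • a = 0 := by
    have := congrArg (a * ·) e
    simpa [mul_add, mul_smul_comm, h.toLeft.idem, (mem_eig2.1 hu).1] using this
  exact ⟨hk, by rwa [hk, zero_add] at e, hwz⟩

end IsJordanAxis

/-- A span closed under multiplication and containing algebra generators is everything. -/
lemma span_eq_top_of_mul_mem {s : Set A} {a b : A}
    (hgen : NonUnitalAlgebra.adjoin F {a, b} = ⊤) (ha : a ∈ s) (hb : b ∈ s)
    (hmul : ∀ x ∈ s, ∀ y ∈ s, x * y ∈ Submodule.span F s) : Submodule.span F s = ⊤ := by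
  have hclosed : ∀ x ∈ Submodule.span F s, ∀ y ∈ Submodule.span F s,
      x * y ∈ Submodule.span F s := by
    intro x hx y hy
    induction hx using Submodule.span_induction with
    | zero => simp
    | add x x' _ _ h h' => rw [add_mul]; exact add_mem h h'
    | smul c x _ h => rw [smul_mul_assoc]; exact Submodule.smul_mem _ _ h
    | mem x hx =>
      induction hy using Submodule.span_induction with
      | zero => simp
      | add y y' _ _ h h' => rw [mul_add]; exact add_mem h h'
      | smul c y _ h => rw [mul_smul_comm]; exact Submodule.smul_mem _ _ h
      | mem y hy => exact hmul x hx y hy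
  rw [eq_top_iff]
  intro z _
  have hz : z ∈ NonUnitalAlgebra.adjoin F {a, b} := by rw [hgen]; trivial
  induction hz using NonUnitalAlgebra.adjoin_induction with
  | mem x hx =>
    rcases hx with rfl | rfl
    · exact Submodule.subset_span ha
    · exact Submodule.subset_span hb
  | add x y _ _ h h' => exact add_mem (h trivial) (h' trivial)
  | zero => exact zero_mem _
  | mul x y _ _ h h' => exact hclosed x (h trivial) y (h' trivial)
  | smul c x _ h => exact Submodule.smul_mem _ _ (h trivial)

end

/-- the non-commutative 3-dimensional case: if `A` is generated by Jordan axes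
`a, b` of types `(l,d)`, `(l',d')` with `l ≠ d`, `l' ≠ d'` and `dim_F A = 3`, then
`l + d = 1`, `l' = d`, `d' = l`, and with `x` the `A_{l,d}(a)`-component of `b`,
`A = F·a ⊕ F·b ⊕ F·x` with `x² = 0`, `a*b = a*x = x*b = l•x`, `b*a = x*a = b*x = d•x`. -/
theorem noncomm_dim_three (hchar : (2 : F) ≠ 0) (l d l' d' : F) (a b : A)
    (ha : IsJordanAxis F A l d a) (hb : IsJordanAxis F A l' d' b)
    (hgen : NonUnitalAlgebra.adjoin F {a, b} = ⊤)
    (hld : l ≠ d) (hld' : l' ≠ d') (hdim : Module.finrank F A = 3)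
    (αb : F) (b0 x : A) (hb0 : b0 ∈ eig2 F A a 0 0) (hx : x ∈ eig2 F A a l d)
    (hdec : b = αb • a + b0 + x) :
    l + d = 1 ∧ l' = d ∧ d' = l ∧
    LinearIndependent F ![a, b, x] ∧ Submodule.span F {a, b, x} = ⊤ ∧
    x * x = 0 ∧
    a * b = l • x ∧ a * x = l • x ∧ x * b = l • x ∧
    b * a = d • x ∧ x * a = d • x ∧ b * x = d • x := by
  have hx1 : a * x = l • x := hx.1
  have hx2 : x * a = d • x := hx.2
  have hb01 : a * b0 = 0 := hb0.1.trans (zero_smul F b0)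
  have hb02 : b0 * a = 0 := hb0.2.trans (zero_smul F b0)
  have haa : a * a = a := ha.toLeft.idem
  have hbb : b * b = b := hb.toLeft.idem
  have hab : a * b = αb • a + l • x := by
    rw [hdec, mul_add, mul_add, mul_smul_comm, haa, hb01, hx1, add_zero]
  have hba : b * a = αb • a + d • x := by
    rw [hdec, add_mul, add_mul, smul_mul_assoc, haa, hb02, hx2, add_zero]
  obtain ⟨β, a0, y, ha0, hy, hdec'⟩ := hb.exists_decomposition a
  have ha01 : b * a0 = 0 := ha0.1.trans (zero_smul F a0)
  have ha02 : a0 * b = 0 := ha0.2.trans (zero_smul F a0)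
  have hab' : a * b = β • b + d' • y := by
    conv_lhs => rw [hdec']
    rw [add_mul, add_mul, smul_mul_assoc, hbb, ha02, hy.2, add_zero]
  have hba' : b * a = β • b + l' • y := by
    conv_lhs => rw [hdec']
    rw [mul_add, mul_add, mul_smul_comm, hbb, ha01, hy.1, add_zero]
  have hdl' : d' - l' ≠ 0 := sub_ne_zero.2 hld'.symm
  obtain ⟨c, hc⟩ : ∃ c : F, c = (d' - l')⁻¹ * (l - d) := ⟨_, rfl⟩
  have hc0 : c ≠ 0 := hc ▸ mul_ne_zero (inv_ne_zero hdl') (sub_ne_zero.2 hld)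
  have hyx : y = c • x := by
    have e : (d' - l') • y = (l - d) • x := by
      have e1 : a * b - b * a = (d' - l') • y := by rw [hab', hba']; module
      rw [← e1, hab, hba]; module
    rw [hc, mul_smul, ← e, inv_smul_smul₀ hdl']
  subst hyx
  have hxb : x ∈ eig2 F A b l' d' := (Submodule.smul_mem_iff _ hc0).1 hy
  have hbx : b * x = l' • x := hxb.1
  have hxb' : x * b = d' • x := hxb.2
  have hspan : x * x ∈ Submodule.span F {a, b, x} → Submodule.span F {a, b, x} = ⊤ := by
    intro hxx
    have hma : a ∈ Submodule.span F {a, b, x} := Submodule.subset_span (by simp)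
    have hmb : b ∈ Submodule.span F {a, b, x} := Submodule.subset_span (by simp)
    have hmx : x ∈ Submodule.span F {a, b, x} := Submodule.subset_span (by simp)
    have hcomb (p q : F) : p • a + q • x ∈ Submodule.span F {a, b, x} :=
      add_mem (Submodule.smul_mem _ _ hma) (Submodule.smul_mem _ _ hmx)
    refine span_eq_top_of_mul_mem hgen (by simp) (by simp) ?_
    rintro u (rfl | rfl | rfl) v (rfl | rfl | rfl)
    · rwa [haa]
    · rw [hab]; exact hcomb _ _
    · rw [hx1]; exact Submodule.smul_mem _ _ hmx
    · rw [hba]; exact hcomb _ _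
    · rwa [hbb]
    · rw [hbx]; exact Submodule.smul_mem _ _ hmx
    · rw [hx2]; exact Submodule.smul_mem _ _ hmx
    · rw [hxb']; exact Submodule.smul_mem _ _ hmx
    · exact hxx
  have hli : x * x ∈ Submodule.span F {a, b, x} → LinearIndependent F ![a, b, x] := by
    intro hxx
    refine linearIndependent_of_top_le_span_of_card_eq_finrank ?_ (by simp [hdim])
    have : Set.range ![a, b, x] = {a, b, x} := by
      simp only [Matrix.range_cons, Matrix.range_empty, Set.union_empty, Set.singleton_union]
    rw [this, hspan hxx]
  have hxz : x ≠ 0 := by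
    rintro rfl
    exact (hli (by simp)).ne_zero 2 rfl
  have hb0z : b0 ≠ 0 := by
    rintro rfl
    rw [add_zero] at hdec
    have hxeq : x * x = 1 • b + (-(αb * αb)) • a + (-(αb * (l + d))) • x := by
      have e : b * b = (αb * αb) • a + (αb * (l + d)) • x + x * x := by
        rw [hdec]
        simp only [mul_add, add_mul, mul_smul_comm, smul_mul_assoc, haa, hx1, hx2]
        module
      rw [hbb] at e
      rw [one_smul]
      conv_rhs => rw [e]
      module
    have hxx : x * x ∈ Submodule.span F {a, b, x} := by
      rw [hxeq]
      exact add_mem (add_mem (Submodule.smul_of_tower_mem _ _ (Submodule.subset_span (by simp)))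
        (Submodule.smul_mem _ _ (Submodule.subset_span (by simp))))
        (Submodule.smul_mem _ _ (Submodule.subset_span (by simp)))
    have hrel : ∑ i, ![αb, -1, 1] i • ![a, b, x] i = 0 := by
      simp [Fin.sum_univ_three, hdec]
    simpa using Fintype.linearIndependent_iff.1 (hli hxx) _ hrel 2
  have hsum : (αb - β * αb) • a + (-β) • b0 + (l - β - d' * c) • x = 0 := by
    have e : αb • a + l • x = β • (αb • a + b0 + x) + d' • c • x := by
      rw [← hdec, ← hab, hab']
    rw [← sub_eq_zero] at e
    rw [← e]; module
  obtain ⟨h1, h2, h3⟩ := ha.components_eq_zero (Submodule.smul_mem _ _ hb0)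
    (Submodule.smul_mem _ _ hx) hsum
  have hβ : β = 0 := neg_eq_zero.1 ((smul_eq_zero.1 h2).resolve_right hb0z)
  subst hβ
  rw [zero_mul, sub_zero] at h1
  rw [h1, zero_add] at hdec hab hba
  rw [zero_smul, zero_add] at hdec'
  have hlc : l = d' * c := by linear_combination (smul_eq_zero.1 h3).resolve_right hxz
  have hdc : d = l' * c := by
    have e : (d - l' * c) • x = 0 := by
      rw [sub_smul, ← hba, hba', zero_smul, zero_add, smul_smul, sub_self]
    linear_combination (smul_eq_zero.1 e).resolve_right hxz
  have hxx : x * x = 0 := ha.mul_self_eq_zero_of_mul_eq_smul hb0 hx hdec hbx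
  have hsum' : l' + d' = 1 := ha.add_eq_one_of_idempotent hb0 hx hdec hbb hbx hxb' hxz
  have hsum'' : l + d = 1 := by
    refine hb.add_eq_one_of_idempotent ha0 hy hdec' haa ?_ ?_ (smul_ne_zero hc0 hxz)
    · rw [mul_smul_comm, hx1, smul_comm]
    · rw [smul_mul_assoc, hx2, smul_comm]
  have hc1 : c = 1 := by linear_combination hsum'' - c * hsum' - hlc - hdc
  rw [hc1, mul_one] at hlc hdc
  have hxm : x * x ∈ Submodule.span F {a, b, x} := by simp [hxx]
  exact ⟨hsum'', hdc.symm, hlc.symm, hli hxm, hspan hxm, hxx, hab, hx1, hlc ▸ hxb', hba, hx2,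
    hdc ▸ hbx⟩
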